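/- Let T ⊂ ℝ² be a triangle with vertices in ℤ² whose sides have affine lengths a, b, c with gcd(a,b,c) = 1. Then the random variable X_T mod a is uniformly distributed on {0, 1, …, a−1} (and likewise X_T mod b and X_T mod c are uniform on {0,…,b−1} and {0,…,c−1} respectively). -/

import Mathlib

open MeasureTheory
open scoped ENNReal

noncomputable section

/-- The embedding of `ℤ²` into `ℝ²`. -/
def toR2 (m : ℤ × ℤ) : ℝ × ℝ := ((m.1 : ℝ), (m.2 : ℝ))

/-- The cross product of two integer vectors. -/
def zcross (v w : ℤ × ℤ) : ℤ := v.1 * w.2 - v.2 * w.1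

/-- `latCount C x = |(C + x) ∩ ℤ²|`, the number of lattice points in the translate `C + x`. -/
def latCount (C : Set (ℝ × ℝ)) (x : ℝ × ℝ) : ℕ :=
  Set.ncard {m : ℤ × ℤ | toR2 m - x ∈ C}

/-- The uniform distribution on the unit square `[0,1]²`. -/
def μunit : Measure (ℝ × ℝ) := volume.restrict (Set.Icc (0 : ℝ × ℝ) 1)

theorem sum_range_mul_of_periodic (h : ℕ → ℤ) (n : ℕ) (hh : ∀ i, h (i + n) = h i) (g : ℕ) :
    ∑ i ∈ Finset.range (g * n), h i = g * ∑ i ∈ Finset.range n, h i := by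
  have hp : ∀ k i, h (k * n + i) = h i := by
    intro k
    induction k with
    | zero => simp
    | succ k ih => intro i; rw [← ih i, ← hh (k * n + i)]; congr 1; ring
  induction g with
  | zero => simp
  | succ g ih =>
    rw [Nat.succ_mul, Finset.sum_range_add, ih]
    simp only [hp]
    push_cast; ring

theorem sum_range_shift_sub_comm (φ : ℕ → ℤ) (m n : ℕ) :
    ∑ i ∈ Finset.range m, (φ (i + n) - φ i) = ∑ i ∈ Finset.range n, (φ (i + m) - φ i) := by
  have h1 := Finset.sum_range_add φ n m
  have h2 := Finset.sum_range_add φ m n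
  rw [add_comm n m, h2] at h1
  simp only [Finset.sum_sub_distrib, add_comm _ n, add_comm _ m]
  linarith

theorem floor_slope_add_period (e : ℤ) {f : ℕ} (hf : 0 < f) (z : ℝ) (i : ℕ) :
    ⌊z + e * ((i + f : ℕ) : ℝ) / f⌋ = ⌊z + e * (i : ℝ) / f⌋ + e := by
  have hf' : (f : ℝ) ≠ 0 := by positivity
  rw [← Int.floor_add_intCast]
  congr 1
  push_cast
  field_simp
  ring

theorem exists_eq_mul_gcd (e : ℤ) {f : ℕ} (hf : 0 < f) :
    ∃ (e' : ℤ) (f' : ℕ), 0 < f' ∧ IsCoprime e' (f' : ℤ) ∧ f = Int.gcd e f * f' ∧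
      ∀ i : ℝ, e * i / f = e' * i / f' := by
  have hg : 0 < Int.gcd e f := Int.gcd_pos_of_ne_zero_right _ (by exact_mod_cast hf.ne')
  obtain ⟨e', f', hco, he, hf'⟩ := Int.exists_gcd_one (m := e) (n := (f : ℤ)) hg
  have hgz : (0 : ℤ) < Int.gcd e f := by exact_mod_cast hg
  have hf'0 : 0 < f' := by
    have : (0 : ℤ) < f' * Int.gcd e f := by rw [← hf']; exact_mod_cast hf
    exact pos_of_mul_pos_left this hgz.le
  lift f' to ℕ using hf'0.le
  have hf'1 : 0 < f' := by exact_mod_cast hf'0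
  refine ⟨e', f', hf'1, Int.isCoprime_iff_gcd_eq_one.2 hco, ?_, ?_⟩
  · have : (f : ℤ) = (f' : ℤ) * (Int.gcd e f : ℤ) := hf'
    rw [mul_comm]; exact_mod_cast this
  · intro i
    have e1 : (e : ℝ) = e' * (Int.gcd e f : ℝ) := by exact_mod_cast he
    have f1 : (f : ℝ) = f' * (Int.gcd e f : ℝ) := by exact_mod_cast hf'
    have hg' : (Int.gcd e f : ℝ) ≠ 0 := by positivity
    generalize (Int.gcd e f : ℝ) = g at *
    rw [e1, f1]
    have : (f' : ℝ) ≠ 0 := by positivity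
    field_simp

theorem gcd_dvd_sum_floor_sub (e : ℤ) {f : ℕ} (hf : 0 < f) (z t : ℝ) :
    (Int.gcd e f : ℤ) ∣
      ∑ i ∈ Finset.range f, (⌊z + t + e * (i : ℝ) / f⌋ - ⌊z + e * (i : ℝ) / f⌋) := by
  obtain ⟨e', f', hf', -, hff, hs⟩ := exists_eq_mul_gcd e hf
  simp only [hs]
  generalize Int.gcd e f = g at *
  subst hff
  rw [sum_range_mul_of_periodic]
  · exact dvd_mul_right _ _
  · intro i
    rw [floor_slope_add_period _ hf', floor_slope_add_period _ hf']
    ring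

theorem sum_floor_sub_of_coprime {e : ℤ} {f : ℕ} (hf : 0 < f) (h : IsCoprime e (f : ℤ)) (z : ℝ) :
    ∑ i ∈ Finset.range f, (⌊z + 1 / f + e * (i : ℝ) / f⌋ - ⌊z + e * (i : ℝ) / f⌋) = 1 := by
  have hfR : (f : ℝ) ≠ 0 := by positivity
  obtain ⟨k, l, hkl⟩ : ∃ (k : ℕ) (l : ℤ), e * k = 1 + l * f := by
    obtain ⟨u, v, huv⟩ := h
    have hfz : (0 : ℤ) < f := by exact_mod_cast hf
    have h1 := Int.emod_nonneg u hfz.ne'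
    refine ⟨(u % f).toNat, -v - e * (u / f), ?_⟩
    rw [Int.toNat_of_nonneg h1]
    have := Int.emod_add_mul_ediv u f
    linear_combination huv + e * this
  have hklR : (e : ℝ) * k = 1 + l * f := by exact_mod_cast hkl
  have hshift (i : ℕ) :
      ⌊z + 1 / f + e * (i : ℝ) / f⌋ = ⌊z + e * ((i + k : ℕ) : ℝ) / f⌋ - l := by
    rw [← Int.floor_sub_intCast]
    congr 1
    push_cast
    field_simp
    linear_combination -hklR
  have hsum := sum_range_shift_sub_comm (fun i => ⌊z + e * (i : ℝ) / f⌋) f k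
  simp only [floor_slope_add_period _ hf, add_sub_cancel_left, Finset.sum_const,
    Finset.card_range, nsmul_eq_mul] at hsum
  simp only [hshift, sub_right_comm _ l, Finset.sum_sub_distrib _ (fun _ => l), hsum,
    Finset.sum_const, Finset.card_range, nsmul_eq_mul]
  linear_combination hkl

theorem sum_floor_sub_eq_gcd (e : ℤ) {f : ℕ} (hf : 0 < f) :
    ∃ t : ℝ, ∀ z : ℝ,
      ∑ i ∈ Finset.range f, (⌊z + t + e * (i : ℝ) / f⌋ - ⌊z + e * (i : ℝ) / f⌋)
        = Int.gcd e f := by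
  obtain ⟨e', f', hf', hco, hff, hs⟩ := exists_eq_mul_gcd e hf
  refine ⟨1 / f', fun z => ?_⟩
  simp only [hs]
  generalize Int.gcd e f = g at *
  subst hff
  rw [sum_range_mul_of_periodic, sum_floor_sub_of_coprime hf' hco, mul_one]
  intro i
  rw [floor_slope_add_period _ hf', floor_slope_add_period _ hf']
  ring

theorem gcd_dvd_sum_ceil_sub (e : ℤ) {f : ℕ} (hf : 0 < f) (z t : ℝ) :
    (Int.gcd e f : ℤ) ∣
      ∑ i ∈ Finset.range f, (⌈z + t + e * (i : ℝ) / f⌉ - ⌈z + e * (i : ℝ) / f⌉) := by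
  have h := gcd_dvd_sum_floor_sub (-e) hf (-z) (-t)
  rw [Int.neg_gcd, ← dvd_neg, ← Finset.sum_neg_distrib] at h
  have hterm (w : ℝ) (i : ℕ) : ⌊-w + (-e : ℤ) * (i : ℝ) / f⌋ = -⌈w + e * (i : ℝ) / f⌉ := by
    rw [← Int.floor_neg]
    congr 1
    push_cast
    ring
  rw [← neg_add] at h
  simp only [hterm] at h
  simpa only [neg_sub, sub_neg_eq_add, neg_add_eq_sub] using h

theorem mem_convexHull_triple {E : Type*} [AddCommGroup E] [Module ℝ E] {A B C z : E} :
    z ∈ convexHull ℝ {A, B, C} ↔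
      ∃ α β γ : ℝ, 0 ≤ α ∧ 0 ≤ β ∧ 0 ≤ γ ∧ α + β + γ = 1 ∧ α • A + β • B + γ • C = z := by
  rw [convexHull_insert (Set.insert_nonempty _ _), convexHull_pair]
  simp only [mem_convexJoin, Set.mem_singleton_iff, exists_eq_left]
  constructor
  · rintro ⟨w, ⟨β, γ, hβ, hγ, hs, rfl⟩, a, c, ha, hc, hac, rfl⟩
    refine ⟨a, c * β, c * γ, ha, by positivity, by positivity, ?_, by module⟩
    linear_combination hac + c * hs
  · rintro ⟨α, β, γ, hα, hβ, hγ, hs, rfl⟩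
    rcases (add_nonneg hβ hγ).eq_or_lt with h | h
    · obtain rfl : β = 0 := by linarith
      obtain rfl : γ = 0 := by linarith
      obtain rfl : α = 1 := by linarith
      exact ⟨B, left_mem_segment _ _ _, by simpa using left_mem_segment ℝ A B⟩
    · refine ⟨(β / (β + γ)) • B + (γ / (β + γ)) • C,
        ⟨_, _, by positivity, by positivity, by field_simp, rfl⟩,
        α, β + γ, hα, h.le, by linarith, ?_⟩
      rw [smul_add, smul_smul, smul_smul, mul_div_cancel₀ _ h.ne', mul_div_cancel₀ _ h.ne',
        add_assoc]

theorem mem_triangle_iff {Q u v : ℤ × ℤ} {b e : ℤ} {f : ℕ} (hb : 0 < b) (hf : 0 < f)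
    (huv : zcross u v ≠ 0) (X Y : ℝ) :
    (Q.1 + X * u.1 + Y * v.1, Q.2 + X * u.2 + Y * v.2) ∈
        convexHull ℝ {toR2 (Q + e • u + (f : ℤ) • v), toR2 Q, toR2 (Q + b • u)} ↔
      0 ≤ Y ∧ e * Y ≤ f * X ∧ f * X ≤ b * f + (e - b) * Y := by
  have hbR : (0 : ℝ) < b := by exact_mod_cast hb
  have hfR : (0 : ℝ) < f := by exact_mod_cast hf
  have hD : (u.1 * v.2 - u.2 * v.1 : ℝ) ≠ 0 := by
    have : ((zcross u v : ℤ) : ℝ) ≠ 0 := by exact_mod_cast huv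
    simpa [zcross] using this
  rw [mem_convexHull_triple]
  simp only [toR2, Prod.smul_mk, Prod.mk_add_mk, Prod.mk.injEq, Prod.fst_add, Prod.snd_add,
    Prod.smul_fst, Prod.smul_snd, smul_eq_mul]
  push_cast
  constructor
  · rintro ⟨α, β, γ, hα, hβ, hγ, hs, h1, h2⟩
    obtain rfl : β = 1 - α - γ := by linarith
    have hX : X = α * e + γ * b := by
      apply mul_right_cancel₀ hD
      linear_combination -v.2 * h1 + v.1 * h2
    have hY : Y = α * f := by
      apply mul_right_cancel₀ hD
      linear_combination u.2 * h1 - u.1 * h2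
    subst hX hY
    refine ⟨by positivity, ?_, ?_⟩
    · nlinarith [mul_nonneg (mul_nonneg hγ hbR.le) hfR.le]
    · nlinarith [mul_nonneg (mul_nonneg hβ hbR.le) hfR.le]
  · rintro ⟨h0, h1, h2⟩
    refine ⟨Y / f, (b * f + (e - b) * Y - f * X) / (b * f), (f * X - e * Y) / (b * f),
      by positivity, div_nonneg (by linarith) (by positivity),
      div_nonneg (by linarith) (by positivity), ?_, ?_, ?_⟩
    · field_simp; ring
    · field_simp; ring
    · field_simp; ring

/-- Count the lattice points of a translated triangle row by row, in rows parallel to the side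
with direction `u`. -/
theorem latCount_eq_sum {Q u v : ℤ × ℤ} {b e : ℤ} {f : ℕ} (hb : 0 < b) (hf : 0 < f)
    (huv : zcross u v * zcross u v = 1) (x y : ℝ) (hy : ∀ n : ℤ, y ≠ n) :
    (latCount (convexHull ℝ {toR2 (Q + e • u + (f : ℤ) • v), toR2 Q, toR2 (Q + b • u)})
        (x * u.1 + y * v.1, x * u.2 + y * v.2) : ℤ) =
      ∑ i ∈ Finset.range f,
        (⌊x + b + (e - b : ℤ) * (⌈y⌉ - y) / f + (e - b : ℤ) * (i : ℝ) / f⌋ + 1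
          - ⌈x + e * (⌈y⌉ - y) / f + e * (i : ℝ) / f⌉) := by
  have huv0 : zcross u v ≠ 0 := fun h => by simp [h] at huv
  have hbR : (0 : ℝ) < b := by exact_mod_cast hb
  have hfR : (0 : ℝ) < f := by exact_mod_cast hf
  set A : ℕ → ℝ := fun i => x + b + (e - b : ℤ) * (⌈y⌉ - y) / f + (e - b : ℤ) * (i : ℝ) / f
  set B : ℕ → ℝ := fun i => x + e * (⌈y⌉ - y) / f + e * (i : ℝ) / f
  have hB (i : ℕ) (n : ℤ) :
      B i ≤ n ↔ e * (((⌈y⌉ + i : ℤ) : ℝ) - y) ≤ f * ((n : ℝ) - x) := by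
    rw [← mul_le_mul_iff_right₀ hfR, ← sub_nonneg, ← sub_nonneg (b := (e : ℝ) * _)]
    apply Iff.of_eq; congr 1
    simp only [B]; push_cast; field_simp; ring
  have hA (i : ℕ) (n : ℤ) :
      n ≤ A i ↔ f * ((n : ℝ) - x) ≤ b * f + (e - b) * (((⌈y⌉ + i : ℤ) : ℝ) - y) := by
    rw [← mul_le_mul_iff_right₀ hfR, ← sub_nonneg, ← sub_nonneg (b := (f : ℝ) * ((n : ℝ) - x))]
    apply Iff.of_eq; congr 1
    simp only [A]; push_cast; field_simp; ring
  have hAB : ∀ i < f, B i ≤ A i := by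
    intro i hi
    have h1 : (i : ℝ) + 1 ≤ f := by exact_mod_cast hi
    have h2 := Int.ceil_lt_add_one y
    have : A i - B i = b * (f - (⌈y⌉ - y) - i) / f := by
      simp only [A, B]; push_cast; field_simp; ring
    have : 0 ≤ A i - B i := by
      rw [this]; exact div_nonneg (mul_nonneg hbR.le (by linarith)) hfR.le
    linarith
  let g : (_ : ℕ) × ℤ → ℤ × ℤ := fun s => Q + s.2 • u + (⌈y⌉ + s.1 : ℤ) • v
  have hgc (s : (_ : ℕ) × ℤ) : zcross (g s - Q) v = s.2 * zcross u v ∧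
      zcross u (g s - Q) = (⌈y⌉ + s.1) * zcross u v := by
    simp only [g, zcross, Prod.fst_add, Prod.snd_add, Prod.fst_sub, Prod.snd_sub,
      Prod.smul_fst, Prod.smul_snd, smul_eq_mul]
    constructor <;> ring
  have hg : Function.Injective g := by
    intro s s' h
    have h1 := hgc s
    rw [h, (hgc s').1, (hgc s').2] at h1
    have e1 := mul_right_cancel₀ huv0 h1.1
    have e2 := mul_right_cancel₀ huv0 h1.2
    cases s; cases s'
    simp only at e1 e2
    subst e1
    simp only [add_right_inj, Nat.cast_inj] at e2
    rw [e2]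
  have hpt (n j : ℤ) : toR2 (Q + n • u + j • v) - (x * u.1 + y * v.1, x * u.2 + y * v.2) =
      (Q.1 + (n - x) * u.1 + (j - y) * v.1, Q.2 + (n - x) * u.2 + (j - y) * v.2) := by
    simp only [toR2, Prod.mk_sub_mk, Prod.fst_add, Prod.snd_add, Prod.smul_fst, Prod.smul_snd,
      smul_eq_mul, Prod.mk.injEq]
    push_cast
    constructor <;> ring
  have hset : {m : ℤ × ℤ | toR2 m - (x * u.1 + y * v.1, x * u.2 + y * v.2) ∈
      convexHull ℝ {toR2 (Q + e • u + (f : ℤ) • v), toR2 Q, toR2 (Q + b • u)}} =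
      (((Finset.range f).sigma fun i => Finset.Icc ⌈B i⌉ ⌊A i⌋).image g : Finset (ℤ × ℤ)) := by
    ext m
    simp only [Set.mem_ofPred_eq, Finset.coe_image, Set.mem_image, Finset.mem_coe,
      Finset.mem_sigma, Finset.mem_range, Finset.mem_Icc, Int.ceil_le, Int.le_floor, hA, hB]
    constructor
    · intro hm
      obtain ⟨n, j, rfl⟩ : ∃ n j : ℤ, m = Q + n • u + j • v := by
        refine ⟨zcross u v * zcross (m - Q) v, zcross u v * zcross u (m - Q), ?_⟩
        ext
        · simp only [zcross, Prod.fst_add, Prod.fst_sub, Prod.snd_sub,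
            Prod.smul_fst, smul_eq_mul] at huv ⊢
          linear_combination (Q.1 - m.1) * huv
        · simp only [zcross, Prod.snd_add, Prod.fst_sub, Prod.snd_sub,
            Prod.smul_snd, smul_eq_mul] at huv ⊢
          linear_combination (Q.2 - m.2) * huv
      rw [hpt, mem_triangle_iff hb hf huv0] at hm
      obtain ⟨h0, h1, h2⟩ := hm
      have hj : ⌈y⌉ ≤ j := Int.ceil_le.2 (by linarith)
      have hjf : (j : ℝ) ≤ y + f := by
        have : (b : ℝ) * (j - y) ≤ b * f := by linarith
        have := le_of_mul_le_mul_left this hbR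
        linarith
      have hjf' : j < ⌈y⌉ + f := by
        have h3 : (j : ℝ) < y + f := lt_of_le_of_ne hjf fun h => hy (j - f) (by
          push_cast; linarith)
        have h4 : ((j - f : ℤ) : ℝ) < y := by push_cast; linarith
        have := Int.lt_ceil.2 h4
        linarith
      obtain ⟨i, rfl⟩ : ∃ i : ℕ, j = ⌈y⌉ + i := ⟨(j - ⌈y⌉).toNat, by omega⟩
      exact ⟨⟨i, n⟩, ⟨by simpa using hjf', h1, h2⟩, rfl⟩
    · rintro ⟨⟨i, n⟩, ⟨hi, h1, h2⟩, rfl⟩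
      simp only [g]
      rw [hpt, mem_triangle_iff hb hf huv0]
      refine ⟨?_, h1, h2⟩
      have := Int.le_ceil y
      push_cast
      have : (0 : ℝ) ≤ i := by positivity
      linarith
  rw [latCount, hset, Set.ncard_coe_finset, Finset.card_image_of_injective _ hg,
    Finset.card_sigma]
  rw [Nat.cast_sum]
  refine Finset.sum_congr rfl fun i hi => ?_
  rw [Int.card_Icc, Int.toNat_of_nonneg]
  have h1 : (⌈B i⌉ : ℝ) < ⌊A i⌋ + 2 := by
    linarith [Int.ceil_lt_add_one (B i), Int.lt_floor_add_one (A i), hAB i (Finset.mem_range.1 hi)]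
  have : ⌈B i⌉ < ⌊A i⌋ + 2 := by exact_mod_cast h1
  linarith

/-- `toR2` as a group homomorphism. -/
def toR2Hom : ℤ × ℤ →+ ℝ × ℝ where
  toFun := toR2
  map_zero' := by simp [toR2]
  map_add' m n := by simp [toR2]

theorem toR2_add (m n : ℤ × ℤ) : toR2 (m + n) = toR2 m + toR2 n := toR2Hom.map_add m n

theorem latCount_add_toR2 (C : Set (ℝ × ℝ)) (x : ℝ × ℝ) (n : ℤ × ℤ) :
    latCount C (x + toR2 n) = latCount C x := by
  unfold latCount
  rw [← Set.ncard_image_of_injective {m : ℤ × ℤ | toR2 m - x ∈ C} (add_left_injective n)]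
  congr 1
  ext m
  simp only [Set.mem_ofPred_eq, Set.image_add_right, Set.mem_preimage, toR2_add]
  have : toR2 (-n) = -toR2 n := toR2Hom.map_neg n
  rw [this]
  congr! 1
  abel

theorem measurable_latCount {C : Set (ℝ × ℝ)} (hC : MeasurableSet C) : Measurable (latCount C) := by
  have hS : MeasurableSet {z : (ℝ × ℝ) × (ℤ × ℤ) | toR2 z.2 - z.1 ∈ C} :=
    ((Measurable.of_discrete (f := toR2)).comp measurable_snd |>.sub measurable_fst) hC
  have h : latCount C = fun x =>
      ⌊(Measure.count (Prod.mk x ⁻¹' {z : (ℝ × ℝ) × (ℤ × ℤ) | toR2 z.2 - z.1 ∈ C})).toReal⌋₊ := by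
    funext x
    rw [Measure.count_apply (Set.to_countable _).measurableSet]
    change ENat.toNat (Set.encard {m : ℤ × ℤ | toR2 m - x ∈ C}) =
      ⌊(ENat.toENNReal (Set.encard {m : ℤ × ℤ | toR2 m - x ∈ C})).toReal⌋₊
    generalize Set.encard {m : ℤ × ℤ | toR2 m - x ∈ C} = n
    cases n <;> simp
  rw [h]
  exact Nat.measurable_floor.comp (measurable_measure_prodMk_left hS).ennreal_toReal

theorem isAddFundamentalDomain_toR2 (s : ℝ × ℝ) :
    IsAddFundamentalDomain toR2Hom.range
      (Set.Ico s.1 (s.1 + 1) ×ˢ Set.Ico s.2 (s.2 + 1)) (volume : Measure (ℝ × ℝ)) := by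
  refine IsAddFundamentalDomain.mk'
    (measurableSet_Ico.prod measurableSet_Ico).nullMeasurableSet fun x => ?_
  obtain ⟨m, hm, hm'⟩ := existsUnique_add_zsmul_mem_Ico (one_pos : (0 : ℝ) < 1) x.1 s.1
  obtain ⟨n, hn, hn'⟩ := existsUnique_add_zsmul_mem_Ico (one_pos : (0 : ℝ) < 1) x.2 s.2
  simp only [zsmul_eq_mul, mul_one, add_comm _ (Int.cast _)] at hm hm' hn hn'
  refine ⟨⟨toR2 (m, n), (m, n), rfl⟩, ⟨hm, hn⟩, ?_⟩
  rintro ⟨_, k, rfl⟩ ⟨h1, h2⟩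
  have e1 := hm' k.1 h1
  have e2 := hn' k.2 h2
  obtain rfl : k = (m, n) := Prod.ext e1 e2
  rfl

theorem μunit_apply {A : Set (ℝ × ℝ)} :
    μunit A = volume (A ∩ Set.Ico (0 : ℝ) 1 ×ˢ Set.Ico (0 : ℝ) 1) := by
  have h : (Set.Icc (0 : ℝ × ℝ) 1) =ᵐ[volume] (Set.Ico (0 : ℝ) 1 ×ˢ Set.Ico (0 : ℝ) 1) := by
    rw [show (Set.Icc (0 : ℝ × ℝ) 1) = Set.Icc (0 : ℝ) 1 ×ˢ Set.Icc (0 : ℝ) 1 from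
      (Set.Icc_prod_Icc 0 1 0 1).symm, Measure.volume_eq_prod]
    exact Measure.set_prod_ae_eq Ico_ae_eq_Icc.symm Ico_ae_eq_Icc.symm
  rw [μunit, Measure.restrict_congr_set h,
    Measure.restrict_apply' (measurableSet_Ico.prod measurableSet_Ico)]

theorem μunit_preimage_add_right {A : Set (ℝ × ℝ)} (hA : MeasurableSet A)
    (hper : ∀ n x, x + toR2 n ∈ A ↔ x ∈ A) (s : ℝ × ℝ) :
    μunit ((· + s) ⁻¹' A) = μunit A := by
  have : Countable toR2Hom.range := Set.countable_range toR2Hom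
  have h1 := (isAddFundamentalDomain_toR2 0).measure_set_eq (isAddFundamentalDomain_toR2 s) hA (by
    rintro ⟨_, n, rfl⟩
    ext x
    rw [Set.mem_preimage, ← hper n x, add_comm]
    rfl)
  rw [μunit_apply, μunit_apply]
  simp only [Prod.fst_zero, Prod.snd_zero, zero_add] at h1
  rw [h1]
  refine Eq.trans (congrArg _ ?_) (measure_preimage_add_right volume s _)
  ext x
  simp [add_comm]

/-- A periodic function to `ZMod a` which is raised by one, almost everywhere, by some translation
is uniformly distributed. -/
theorem μunit_fiber_of_shift {a : ℕ} [NeZero a] {F : ℝ × ℝ → ZMod a} (hF : Measurable F)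
    (hper : ∀ n x, F (x + toR2 n) = F x) {s : ℝ × ℝ}
    (hs : ∀ᵐ x, F (x + s) = F x + 1) (k : ZMod a) :
    μunit (F ⁻¹' {k}) = (a : ℝ≥0∞)⁻¹ := by
  have hmeas (k) : MeasurableSet (F ⁻¹' {k}) := hF (measurableSet_singleton k)
  have hstep (k : ZMod a) : μunit (F ⁻¹' {k + 1}) = μunit (F ⁻¹' {k}) := by
    rw [← μunit_preimage_add_right (hmeas (k + 1)) (by simp [hper]) s]
    apply measure_congr
    filter_upwards [ae_restrict_of_ae hs] with x hx
    apply propext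
    change F (x + s) = k + 1 ↔ F x = k
    rw [hx, add_left_inj]
  have hconst (n : ℕ) : μunit (F ⁻¹' {(n : ZMod a)}) = μunit (F ⁻¹' {0}) := by
    induction n with
    | zero => simp
    | succ n ih => rw [Nat.cast_succ, hstep, ih]
  have hconst' (k : ZMod a) : μunit (F ⁻¹' {k}) = μunit (F ⁻¹' {0}) := by
    rw [← hconst k.val, ZMod.natCast_zmod_val]
  have hone : μunit Set.univ = 1 := by
    rw [μunit_apply, Set.univ_inter, Measure.volume_eq_prod, Measure.prod_prod]
    simp
  have hsum : ∑ k : ZMod a, μunit (F ⁻¹' {k}) = 1 := by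
    rw [← hone, ← measure_biUnion_finset (fun i _ j _ hij => ?_) fun k _ => hmeas k]
    · congr 1; ext; simp
    · exact Disjoint.preimage _ (by simpa using hij)
  simp only [hconst', Finset.sum_const, Finset.card_univ, ZMod.card, nsmul_eq_mul] at hsum ⊢
  exact ENNReal.eq_inv_of_mul_eq_one_left (by rwa [mul_comm])

theorem gcd_smul_add_smul {u v : ℤ × ℤ} (huv : zcross u v * zcross u v = 1) (x y : ℤ) :
    Int.gcd (x • u + y • v).1 (x • u + y • v).2 = Int.gcd x y := by
  simp only [zcross, Prod.fst_add, Prod.snd_add, Prod.smul_fst, Prod.smul_snd,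
    smul_eq_mul] at huv ⊢
  apply Nat.dvd_antisymm
  · apply Int.dvd_gcd
    · have := ((Int.gcd_dvd_left (x * u.1 + y * v.1) (x * u.2 + y * v.2)).mul_right v.2).sub
        ((Int.gcd_dvd_right (x * u.1 + y * v.1) (x * u.2 + y * v.2)).mul_right v.1)
      exact (this.mul_right (u.1 * v.2 - u.2 * v.1)).trans
        (dvd_of_eq (by linear_combination x * huv))
    · have := ((Int.gcd_dvd_right (x * u.1 + y * v.1) (x * u.2 + y * v.2)).mul_right u.1).sub
        ((Int.gcd_dvd_left (x * u.1 + y * v.1) (x * u.2 + y * v.2)).mul_right u.2)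
      exact (this.mul_right (u.1 * v.2 - u.2 * v.1)).trans
        (dvd_of_eq (by linear_combination y * huv))
  · apply Int.dvd_gcd
    · exact ((Int.gcd_dvd_left x y).mul_right _).add ((Int.gcd_dvd_right x y).mul_right _)
    · exact ((Int.gcd_dvd_left x y).mul_right _).add ((Int.gcd_dvd_right x y).mul_right _)

theorem exists_adapted_basis {P Q R : ℤ × ℤ} (h : zcross (Q - P) (R - P) ≠ 0) :
    ∃ (u v : ℤ × ℤ) (b e : ℤ) (f : ℕ), 0 < b ∧ 0 < f ∧ zcross u v * zcross u v = 1 ∧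
      P = Q + e • u + (f : ℤ) • v ∧ R = Q + b • u := by
  have hg : 0 < Int.gcd (R - Q).1 (R - Q).2 := by
    refine Nat.pos_of_ne_zero fun h0 => h ?_
    rw [Int.gcd_eq_zero_iff] at h0
    simp only [zcross, Prod.fst_sub, Prod.snd_sub] at h0 ⊢
    linear_combination (Q.1 - P.1) * h0.2 - (Q.2 - P.2) * h0.1
  obtain ⟨u1, u2, hco, h1, h2⟩ := Int.exists_gcd_one hg
  set b := Int.gcd (R - Q).1 (R - Q).2
  obtain ⟨s, t, hst⟩ := Int.isCoprime_iff_gcd_eq_one.2 hco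
  simp only [Prod.fst_sub, Prod.snd_sub] at h1 h2
  set e : ℤ := (P.1 - Q.1) * s + (P.2 - Q.2) * t
  set f : ℤ := u1 * (P.2 - Q.2) - u2 * (P.1 - Q.1) with hf
  have hf0 : f ≠ 0 := by
    intro h0
    apply h
    simp only [zcross, Prod.fst_sub, Prod.snd_sub]
    linear_combination (Q.1 - P.1) * h2 - (Q.2 - P.2) * h1 + b * h0
  have hR : R = Q + (b : ℤ) • (u1, u2) := by
    ext
    · simp; linear_combination h1
    · simp; linear_combination h2
  have hP : P = Q + e • (u1, u2) + f • (-t, s) := by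
    ext
    · simp [e, f]; linear_combination (Q.1 - P.1) * hst
    · simp [e, f]; linear_combination (Q.2 - P.2) * hst
  have hb : (0 : ℤ) < b := by exact_mod_cast hg
  rcases lt_or_gt_of_ne hf0 with hneg | hpos
  · refine ⟨(u1, u2), (t, -s), b, e, f.natAbs, hb, Int.natAbs_pos.2 hf0, ?_, ?_, hR⟩
    · simp only [zcross]
      linear_combination (s * u1 + t * u2 + 1) * hst
    · rw [Int.ofNat_natAbs_of_nonpos hneg.le]
      convert hP using 2
      simp
  · refine ⟨(u1, u2), (-t, s), b, e, f.natAbs, hb, Int.natAbs_pos.2 hf0, ?_, ?_, hR⟩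
    · simp only [zcross]
      linear_combination (s * u1 + t * u2 + 1) * hst
    · rwa [Int.natAbs_of_nonneg hpos.le]

theorem ae_linear_ne_int {α β : ℝ} (h : α ≠ 0 ∨ β ≠ 0) :
    ∀ᵐ x : ℝ × ℝ, ∀ n : ℤ, α * x.1 + β * x.2 ≠ n := by
  let L : ℝ × ℝ →ₗ[ℝ] ℝ := α • LinearMap.fst ℝ ℝ ℝ + β • LinearMap.snd ℝ ℝ ℝ
  have hL : Function.Surjective L := by
    intro y
    rcases h with h | h
    · exact ⟨(y / α, 0), by simp [L]; field_simp⟩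
    · exact ⟨(0, y / β), by simp [L]; field_simp⟩
  have hc : (Set.range ((↑) : ℤ → ℝ)).Countable := Set.countable_range _
  have := (ae_comp_linearMap_mem_iff L volume volume hL hc.measurableSet.compl).2
    (measure_eq_zero_iff_ae_notMem.1 (hc.measure_zero volume))
  filter_upwards [this] with x hx n hn
  exact hx ⟨n, by simpa [L] using hn.symm⟩

/-- Some translation parallel to the side `QR` changes the number of lattice points by the affine
length of `PR` modulo the affine length of `PQ`. -/
theorem exists_shift_latCount {P Q R : ℤ × ℤ} (h : zcross (Q - P) (R - P) ≠ 0) :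
    ∃ s : ℝ × ℝ, ∀ᵐ x,
      (latCount (convexHull ℝ {toR2 P, toR2 Q, toR2 R}) (x + s) :
          ZMod (Int.gcd (Q - P).1 (Q - P).2)) =
        latCount (convexHull ℝ {toR2 P, toR2 Q, toR2 R}) x + Int.gcd (P - R).1 (P - R).2 := by
  obtain ⟨u, v, b, e, f, hb, hf, huv, rfl, rfl⟩ := exists_adapted_basis h
  have hgQ : Int.gcd (Q - (Q + e • u + (f : ℤ) • v)).1 (Q - (Q + e • u + (f : ℤ) • v)).2 =
      Int.gcd e f := by
    rw [show Q - (Q + e • u + (f : ℤ) • v) = (-e) • u + (-f : ℤ) • v by module,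
      gcd_smul_add_smul huv, Int.neg_gcd, Int.gcd_neg]
  have hgR : Int.gcd (Q + e • u + (f : ℤ) • v - (Q + b • u)).1
      (Q + e • u + (f : ℤ) • v - (Q + b • u)).2 = Int.gcd (e - b) f := by
    rw [show Q + e • u + (f : ℤ) • v - (Q + b • u) = (e - b) • u + (f : ℤ) • v by module,
      gcd_smul_add_smul huv]
  rw [hgQ, hgR]
  obtain ⟨t, ht⟩ := sum_floor_sub_eq_gcd (e - b) hf
  have huvR : (u.1 * v.2 - u.2 * v.1 : ℝ) * (u.1 * v.2 - u.2 * v.1) = 1 := by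
    have : ((zcross u v * zcross u v : ℤ) : ℝ) = 1 := by rw [huv]; simp
    simpa [zcross] using this
  set δ : ℝ := u.1 * v.2 - u.2 * v.1 with hδ
  have hne : -δ * u.2 ≠ 0 ∨ δ * u.1 ≠ 0 := by
    by_contra! h0
    have : δ * δ = 0 := by
      linear_combination δ * hδ + v.2 * h0.2 + v.1 * h0.1
    rw [huvR] at this
    exact one_ne_zero this
  refine ⟨(t * u.1, t * u.2), ?_⟩
  filter_upwards [ae_linear_ne_int hne] with z hz
  obtain ⟨y, hy⟩ : ∃ y, y = -δ * u.2 * z.1 + δ * u.1 * z.2 := ⟨_, rfl⟩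
  simp only [← hy] at hz
  obtain ⟨x, rfl⟩ : ∃ x : ℝ, z = (x * u.1 + y * v.1, x * u.2 + y * v.2) := by
    refine ⟨δ * (z.1 * v.2 - z.2 * v.1), ?_⟩
    ext
    · simp only [hy]; linear_combination -z.1 * huvR + δ * z.1 * hδ
    · simp only [hy]; linear_combination -z.2 * huvR + δ * z.2 * hδ
  have hadd : (x * u.1 + y * v.1, x * u.2 + y * v.2) + (t * u.1, t * u.2) =
      ((x + t) * u.1 + y * v.1, (x + t) * u.2 + y * v.2) := by
    ext <;> simp <;> ring
  have h1 := latCount_eq_sum (Q := Q) (e := e) hb hf huv (x + t) y hz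
  have h2 := latCount_eq_sum (Q := Q) (e := e) hb hf huv x y hz
  rw [hadd]
  set N₁ := latCount _ ((x + t) * u.1 + y * v.1, (x + t) * u.2 + y * v.2)
  set N₂ := latCount _ (x * u.1 + y * v.1, x * u.2 + y * v.2)
  have hA := ht (x + b + (e - b : ℤ) * (⌈y⌉ - y) / f)
  have hB := gcd_dvd_sum_ceil_sub e hf (x + e * (⌈y⌉ - y) / f) t
  rw [show x + b + (e - b : ℤ) * (⌈y⌉ - y) / f + t = x + t + b + (e - b : ℤ) * (⌈y⌉ - y) / f by
    ring] at hA
  rw [show x + e * (⌈y⌉ - y) / f + t = x + t + e * (⌈y⌉ - y) / f by ring] at hB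
  have key : (Int.gcd e f : ℤ) ∣ (N₂ + Int.gcd (e - b) f : ℤ) - N₁ := by
    convert hB using 1
    rw [← hA, h1, h2]
    simp only [Finset.sum_sub_distrib, Finset.sum_add_distrib]
    ring
  have := (ZMod.intCast_eq_intCast_iff_dvd_sub _ _ _).2 key
  exact_mod_cast this

/-- The amounts by which `F` changes, almost everywhere, under some translation. -/
def shiftAmounts {A : Type*} [AddGroup A] (F : ℝ × ℝ → A) : AddSubgroup A where
  carrier := {d | ∃ s, ∀ᵐ x, F (x + s) = F x + d}
  zero_mem' := ⟨0, by simp⟩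
  add_mem' := by
    rintro d d' ⟨s, hs⟩ ⟨s', hs'⟩
    refine ⟨s + s', ?_⟩
    filter_upwards [hs, (quasiMeasurePreserving_add_right volume s).ae hs'] with x h h'
    rw [← add_assoc, h', h, add_assoc]
  neg_mem' := by
    rintro d ⟨s, hs⟩
    refine ⟨-s, ?_⟩
    filter_upwards [(quasiMeasurePreserving_add_right volume (-s)).ae hs] with x h
    rw [neg_add_cancel_right] at h
    rw [h, add_neg_cancel_right]

theorem μunit_latCount_mod_eq {p q r : ℤ × ℤ} (hT : zcross (q - p) (r - p) ≠ 0)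
    {a b c : ℕ} (ha : a = Int.gcd (q - p).1 (q - p).2) (hb : b = Int.gcd (r - q).1 (r - q).2)
    (hc : c = Int.gcd (p - r).1 (p - r).2) (hgcd : Nat.gcd a (Nat.gcd b c) = 1)
    (k : ℕ) (hk : k < a) :
    μunit {x | latCount (convexHull ℝ {toR2 p, toR2 q, toR2 r}) x % a = k} = (a : ℝ≥0∞)⁻¹ := by
  have : NeZero a := ⟨by omega⟩
  set T := convexHull ℝ {toR2 p, toR2 q, toR2 r} with hTdef
  let F : ℝ × ℝ → ZMod a := fun x => latCount T x
  have hTm : MeasurableSet T :=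
    (Set.Finite.isCompact_convexHull ℝ (by simp)).isClosed.measurableSet
  have hF : Measurable F := (Measurable.of_discrete (f := ((↑) : ℕ → ZMod a))).comp
    (measurable_latCount hTm)
  have hcF : (c : ZMod a) ∈ shiftAmounts F := by
    have := exists_shift_latCount hT
    rwa [← ha, ← hc] at this
  have hbF : (b : ZMod a) ∈ shiftAmounts F := by
    have hT' : zcross (p - q) (r - q) ≠ 0 := by
      contrapose! hT
      simp only [zcross, Prod.fst_sub, Prod.snd_sub] at hT ⊢
      linear_combination -hT
    have := exists_shift_latCount hT'
    rw [Set.insert_comm, ← neg_sub q p, ← neg_sub r q, Prod.fst_neg, Prod.snd_neg, Prod.fst_neg,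
      Prod.snd_neg, Int.neg_gcd, Int.gcd_neg, Int.neg_gcd, Int.gcd_neg, ← ha, ← hb] at this
    exact this
  have hone : (1 : ZMod a) ∈ shiftAmounts F := by
    have hg : ((Nat.gcd b c : ℕ) : ZMod a) ∈ shiftAmounts F := by
      have h := Nat.gcd_eq_gcd_ab b c
      have h' : ((Nat.gcd b c : ℕ) : ZMod a) = b.gcdA c • (b : ZMod a) + b.gcdB c • (c : ZMod a) := by
        rw [zsmul_eq_mul, zsmul_eq_mul, ← Int.cast_natCast (Nat.gcd b c), h]
        push_cast
        ring
      rw [h']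
      exact add_mem (zsmul_mem hbF _) (zsmul_mem hcF _)
    have h := Nat.gcd_eq_gcd_ab a (Nat.gcd b c)
    rw [hgcd] at h
    have h' : (1 : ZMod a) = a.gcdB (Nat.gcd b c) • ((Nat.gcd b c : ℕ) : ZMod a) := by
      have := congrArg (Int.cast : ℤ → ZMod a) h
      rw [zsmul_eq_mul]
      push_cast at this
      rw [this, ZMod.natCast_self]
      ring
    rw [h']
    exact zsmul_mem hg _
  obtain ⟨s, hs⟩ := hone
  rw [← μunit_fiber_of_shift hF (fun n x => by simp only [F, latCount_add_toR2]) hs k]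
  congr 1
  ext x
  change latCount T x % a = k ↔ (latCount T x : ZMod a) = k
  rw [ZMod.natCast_eq_natCast_iff', Nat.mod_eq_of_lt hk]

/-- Let `T` be an integer triangle whose sides have affine lengths
`a, b, c` with `gcd(a,b,c) = 1`. Then `X_T mod a` is uniform on `{0, …, a-1}`, and likewise
`X_T mod b` and `X_T mod c` are uniform on `{0, …, b-1}` and `{0, …, c-1}`. -/
theorem latCount_triangle_mod_uniform (p q r : ℤ × ℤ)
    (hT : zcross (q - p) (r - p) ≠ 0)
    (T : Set (ℝ × ℝ)) (hTdef : T = convexHull ℝ {toR2 p, toR2 q, toR2 r})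
    (a b c : ℕ)
    (ha : a = Int.gcd (q - p).1 (q - p).2)
    (hb : b = Int.gcd (r - q).1 (r - q).2)
    (hc : c = Int.gcd (p - r).1 (p - r).2)
    (hgcd : Nat.gcd a (Nat.gcd b c) = 1) :
    (∀ k : ℕ, k < a → μunit {x | latCount T x % a = k} = (a : ℝ≥0∞)⁻¹) ∧
    (∀ k : ℕ, k < b → μunit {x | latCount T x % b = k} = (b : ℝ≥0∞)⁻¹) ∧
    (∀ k : ℕ, k < c → μunit {x | latCount T x % c = k} = (c : ℝ≥0∞)⁻¹) := by
  subst hTdef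
  have hcyc : zcross (r - q) (p - q) ≠ 0 := by
    contrapose! hT
    simp only [zcross, Prod.fst_sub, Prod.snd_sub] at hT ⊢
    linear_combination hT
  have hcyc' : zcross (p - r) (q - r) ≠ 0 := by
    contrapose! hT
    simp only [zcross, Prod.fst_sub, Prod.snd_sub] at hT ⊢
    linear_combination hT
  refine ⟨μunit_latCount_mod_eq hT ha hb hc hgcd, ?_, ?_⟩
  · rw [Set.insert_comm, Set.pair_comm]
    refine μunit_latCount_mod_eq hcyc hb hc ha ?_
    rw [← hgcd, Nat.gcd_comm a, Nat.gcd_assoc]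
  · rw [Set.pair_comm, Set.insert_comm]
    refine μunit_latCount_mod_eq hcyc' hc ha hb ?_
    rw [← hgcd, ← Nat.gcd_assoc, Nat.gcd_comm c a, Nat.gcd_assoc, Nat.gcd_comm c b]
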